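/- Let σ be non-decreasing and L-Lipschitz with a fixed measurable (sub)derivative σ' satisfying 0 ≤ σ' ≤ L, let D_x be a distribution on ℝ^d with E[‖x‖₂²] ≤ B², fix v ∈ ℝ^d with ‖v‖₂ ≤ 1, and consider gradient descent on the population risk: w_{t+1} = w_t − η·E_x[(σ(w_tᵀx) − σ(vᵀx))·σ'(w_tᵀx)·x], with initialization ‖w₀‖₂ ≤ 2 and step size η ≤ L⁻²·B⁻². Then for every T, ‖w_{t+1} − v‖₂ ≤ ‖w_t − v‖₂ for all t < T, and ‖w₀ − v‖₂² − ‖w_T − v‖₂² ≥ η·L⁻¹·Σ_{t=0}^{T−1} H(w_t), where H(w) := (1/2)·E_x[(σ(wᵀx) − σ(vᵀx))²·σ'(wᵀx)]. -/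

import Mathlib

open MeasureTheory Real
open scoped InnerProductSpace ENNReal

theorem step_aux {d : ℕ} (μx : Measure (EuclideanSpace ℝ (Fin d)))
    [IsProbabilityMeasure μx] (σ σ' : ℝ → ℝ) (L B η : ℝ)
    (hσmeas : Measurable σ) (hσ'meas : Measurable σ') (hσmono : Monotone σ) (hL : 0 < L)
    (hσlip : ∀ z₁ z₂ : ℝ, |σ z₁ - σ z₂| ≤ L * |z₁ - z₂|)
    (hσ'nonneg : ∀ z, 0 ≤ σ' z) (hσ'le : ∀ z, σ' z ≤ L)
    (hmom : Integrable (fun x => ‖x‖ ^ 2) μx) (hB : ∫ x, ‖x‖ ^ 2 ∂μx ≤ B ^ 2)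
    (v w w' : EuclideanSpace ℝ (Fin d))
    (hupd : w' = w -
      η • ∫ x, ((σ ⟪w, x⟫_ℝ - σ ⟪v, x⟫_ℝ) * σ' ⟪w, x⟫_ℝ) • x ∂μx)
    (hη : 0 < η) (hηle : η ≤ (L ^ 2)⁻¹ * (B ^ 2)⁻¹) :
    0 ≤ ∫ x, (σ ⟪w, x⟫_ℝ - σ ⟪v, x⟫_ℝ) ^ 2 * σ' ⟪w, x⟫_ℝ ∂μx ∧
    η * L⁻¹ * ∫ x, (σ ⟪w, x⟫_ℝ - σ ⟪v, x⟫_ℝ) ^ 2 * σ' ⟪w, x⟫_ℝ ∂μx ≤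
        ‖w - v‖ ^ 2 - ‖w' - v‖ ^ 2 := by
  have hB2 : 0 < B ^ 2 := by
    rcases (sq_nonneg B).lt_or_eq with h | h
    · exact h
    · rw [← h] at hηle
      simp at hηle
      linarith
  have hi : ∀ a : EuclideanSpace ℝ (Fin d), Measurable (fun x => ⟪a, x⟫_ℝ) := fun a =>
    (continuous_const.inner continuous_id).measurable
  set e : EuclideanSpace ℝ (Fin d) → ℝ := fun x => σ ⟪w, x⟫_ℝ - σ ⟪v, x⟫_ℝ with he
  set s : EuclideanSpace ℝ (Fin d) → ℝ := fun x => σ' ⟪w, x⟫_ℝ with hs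
  have hem : Measurable e := (hσmeas.comp (hi w)).sub (hσmeas.comp (hi v))
  have hsm : Measurable s := hσ'meas.comp (hi w)
  have hs0 : ∀ x, 0 ≤ s x := fun x => hσ'nonneg _
  have hsL : ∀ x, s x ≤ L := fun x => hσ'le _
  have hel : ∀ x, |e x| ≤ L * |⟪w - v, x⟫_ℝ| := by
    intro x
    rw [inner_sub_left]
    exact hσlip _ _
  have heb : ∀ x, |e x| ≤ L * (‖w - v‖ * ‖x‖) := fun x =>
    (hel x).trans (mul_le_mul_of_nonneg_left (abs_real_inner_le_norm _ _) hL.le)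
  have hes : ∀ x, e x ^ 2 ≤ L * (e x * ⟪w - v, x⟫_ℝ) := by
    intro x
    have h0 : 0 ≤ e x * ⟪w - v, x⟫_ℝ := by
      rw [inner_sub_left]
      rcases le_total ⟪w, x⟫_ℝ ⟪v, x⟫_ℝ with h | h
      · exact mul_nonneg_of_nonpos_of_nonpos (sub_nonpos.2 (hσmono h)) (sub_nonpos.2 h)
      · exact mul_nonneg (sub_nonneg.2 (hσmono h)) (sub_nonneg.2 h)
    rw [← abs_of_nonneg h0, abs_mul, ← sq_abs]
    nlinarith [hel x, abs_nonneg (e x)]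
  have hgi : Integrable (fun x => (e x * s x) • x) μx := by
    refine Integrable.mono' (hmom.const_mul (L * ‖w - v‖ * L))
      ((hem.mul hsm).smul measurable_id).aestronglyMeasurable (Filter.Eventually.of_forall ?_)
    intro x
    rw [norm_smul, norm_mul, Real.norm_eq_abs, Real.norm_eq_abs, abs_of_nonneg (hs0 x)]
    calc |e x| * s x * ‖x‖ ≤ (L * (‖w - v‖ * ‖x‖)) * L * ‖x‖ := by
          gcongr
          · exact hs0 x
          · exact heb x
          · exact hsL x
      _ = _ := by ring
  have hKi : Integrable (fun x => e x ^ 2 * s x) μx := by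
    refine Integrable.mono' (hmom.const_mul ((L * ‖w - v‖) ^ 2 * L))
      ((hem.pow_const 2).mul hsm).aestronglyMeasurable (Filter.Eventually.of_forall ?_)
    intro x
    rw [norm_mul, norm_pow, Real.norm_eq_abs, Real.norm_eq_abs, abs_of_nonneg (hs0 x)]
    calc |e x| ^ 2 * s x ≤ (L * (‖w - v‖ * ‖x‖)) ^ 2 * L := by
          gcongr
          · exact hs0 x
          · exact heb x
          · exact hsL x
      _ = _ := by ring
  change 0 ≤ ∫ x, e x ^ 2 * s x ∂μx ∧ η * L⁻¹ * ∫ x, e x ^ 2 * s x ∂μx ≤ _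
  change w' = w - η • ∫ x, (e x * s x) • x ∂μx at hupd
  set g := ∫ x, (e x * s x) • x ∂μx with hg
  have hK0 : 0 ≤ ∫ x, e x ^ 2 * s x ∂μx :=
    integral_nonneg fun x => mul_nonneg (sq_nonneg _) (hs0 x)
  have hin : ∀ a : EuclideanSpace ℝ (Fin d),
      ⟪a, g⟫_ℝ = ∫ x, e x * s x * ⟪a, x⟫_ℝ ∂μx := by
    intro a
    rw [hg, ← integral_inner hgi a]
    simp only [real_inner_smul_right]
  have hii : ∀ a : EuclideanSpace ℝ (Fin d),
      Integrable (fun x => e x * s x * ⟪a, x⟫_ℝ) μx := by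
    intro a
    have := hgi.const_inner (𝕜 := ℝ) a
    simpa only [real_inner_smul_right] using this
  have h1 : ∫ x, e x ^ 2 * s x ∂μx ≤ L * ⟪w - v, g⟫_ℝ := by
    rw [hin, ← integral_const_mul]
    refine integral_mono hKi ((hii _).const_mul L) fun x => ?_
    have := mul_le_mul_of_nonneg_right (hes x) (hs0 x)
    dsimp only
    linarith
  have h2 : ‖g‖ ^ 2 ≤ B ^ 2 * L * ∫ x, e x ^ 2 * s x ∂μx := by
    have h3 : ‖g‖ ^ 2 ≤ ∫ x, (B ^ 2 * L / 2 * (e x ^ 2 * s x)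
        + ‖g‖ ^ 2 / (2 * B ^ 2) * ‖x‖ ^ 2) ∂μx := by
      refine ((real_inner_self_eq_norm_sq g).symm.trans (hin g)).le.trans ?_
      refine integral_mono (hii g) ((hKi.const_mul _).add (hmom.const_mul _)) fun x => ?_
      dsimp only
      have hcs : ⟪g, x⟫_ℝ ^ 2 ≤ ‖g‖ ^ 2 * ‖x‖ ^ 2 := by
        rw [← mul_pow, ← sq_abs]
        exact pow_le_pow_left₀ (abs_nonneg _) (abs_real_inner_le_norm _ _) 2
      have ha : (e x * s x) ^ 2 ≤ L * (e x ^ 2 * s x) := by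
        have := mul_le_mul_of_nonneg_left (hsL x) (mul_nonneg (sq_nonneg (e x)) (hs0 x))
        linarith
      have hd : ‖g‖ ^ 2 / (2 * B ^ 2) * ‖x‖ ^ 2 = (‖g‖ ^ 2 * ‖x‖ ^ 2) / (2 * B ^ 2) := by ring
      have hb : ⟪g, x⟫_ℝ ^ 2 / (2 * B ^ 2) ≤ ‖g‖ ^ 2 / (2 * B ^ 2) * ‖x‖ ^ 2 := by
        rw [hd]; gcongr
      have hc : e x * s x * ⟪g, x⟫_ℝ ≤
          B ^ 2 / 2 * (e x * s x) ^ 2 + ⟪g, x⟫_ℝ ^ 2 / (2 * B ^ 2) := by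
        have : B ^ 2 / 2 * (e x * s x) ^ 2 + ⟪g, x⟫_ℝ ^ 2 / (2 * B ^ 2) - e x * s x * ⟪g, x⟫_ℝ
          = (B ^ 2 * (e x * s x) - ⟪g, x⟫_ℝ) ^ 2 / (2 * B ^ 2) := by
          have : B ≠ 0 := by rintro rfl; simp at hB2
          field_simp
          ring
        have : 0 ≤ (B ^ 2 * (e x * s x) - ⟪g, x⟫_ℝ) ^ 2 / (2 * B ^ 2) := by positivity
        linarith
      have := mul_le_mul_of_nonneg_left ha (half_pos hB2).le
      linarith
    rw [integral_add (hKi.const_mul _) (hmom.const_mul _), integral_const_mul,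
      integral_const_mul] at h3
    have h4 : ‖g‖ ^ 2 / (2 * B ^ 2) * ∫ x, ‖x‖ ^ 2 ∂μx ≤ ‖g‖ ^ 2 / (2 * B ^ 2) * B ^ 2 := by
      gcongr
    have h5 : ‖g‖ ^ 2 / (2 * B ^ 2) * B ^ 2 = ‖g‖ ^ 2 / 2 := by
      have : B ≠ 0 := by rintro rfl; simp at hB2
      field_simp
    linarith
  refine ⟨hK0, ?_⟩
  set K := ∫ x, e x ^ 2 * s x ∂μx with hK
  have hn : ‖w' - v‖ ^ 2 = ‖w - v‖ ^ 2 - 2 * η * ⟪w - v, g⟫_ℝ + η ^ 2 * ‖g‖ ^ 2 := by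
    have : w' - v = (w - v) - η • g := by rw [hupd]; abel
    rw [this, norm_sub_sq_real, real_inner_smul_right, norm_smul, mul_pow, Real.norm_eq_abs,
      sq_abs]
    ring
  have h6 : L⁻¹ * K ≤ ⟪w - v, g⟫_ℝ := by
    rw [inv_mul_le_iff₀ hL]; exact h1
  have h7 : η * ‖g‖ ^ 2 ≤ L⁻¹ * K := by
    calc η * ‖g‖ ^ 2 ≤ ((L ^ 2)⁻¹ * (B ^ 2)⁻¹) * (B ^ 2 * L * K) := by gcongr
      _ = L⁻¹ * K := by
        have : B ≠ 0 := by rintro rfl; simp at hB2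
        field_simp
  rw [hn]
  nlinarith [mul_le_mul_of_nonneg_left h6 hη.le, mul_le_mul_of_nonneg_left h7 hη.le]

/-- Lemma: key lemma for gradient descent on the population risk,
realizable setting. With `σ` non-decreasing and `L`-Lipschitz, (sub)derivative
`0 ≤ σ' ≤ L`, `E[‖x‖²] ≤ B²`, `‖v‖ ≤ 1`, initialization `‖w₀‖ ≤ 2`, and step size
`η ≤ L⁻²·B⁻²`, gradient descent on the population risk satisfies, for every `T`:
`‖w_{t+1} − v‖ ≤ ‖w_t − v‖` for all `t < T`, and
`‖w₀ − v‖² − ‖w_T − v‖² ≥ η·L⁻¹·Σ_{t<T} H(w_t)`. -/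
theorem statement14 {d : ℕ} (μx : Measure (EuclideanSpace ℝ (Fin d)))
    [IsProbabilityMeasure μx] (σ σ' : ℝ → ℝ) (L B η : ℝ)
    (hσmeas : Measurable σ) (hσ'meas : Measurable σ') (hσmono : Monotone σ) (hL : 0 < L)
    (hσlip : ∀ z₁ z₂ : ℝ, |σ z₁ - σ z₂| ≤ L * |z₁ - z₂|)
    (hσ'nonneg : ∀ z, 0 ≤ σ' z) (hσ'le : ∀ z, σ' z ≤ L)
    (hmom : Integrable (fun x => ‖x‖ ^ 2) μx) (hB : ∫ x, ‖x‖ ^ 2 ∂μx ≤ B ^ 2)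
    (v : EuclideanSpace ℝ (Fin d)) (hv : ‖v‖ ≤ 1)
    (w : ℕ → EuclideanSpace ℝ (Fin d)) (hw0 : ‖w 0‖ ≤ 2)
    (hupd : ∀ t : ℕ, w (t + 1) = w t -
      η • ∫ x, ((σ ⟪w t, x⟫_ℝ - σ ⟪v, x⟫_ℝ) * σ' ⟪w t, x⟫_ℝ) • x ∂μx)
    (hη : 0 < η) (hηle : η ≤ (L ^ 2)⁻¹ * (B ^ 2)⁻¹) (T : ℕ) :
    (∀ t < T, ‖w (t + 1) - v‖ ≤ ‖w t - v‖) ∧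
      η * L⁻¹ * ∑ t ∈ Finset.range T,
          ((1 / 2) * ∫ x, (σ ⟪w t, x⟫_ℝ - σ ⟪v, x⟫_ℝ) ^ 2 * σ' ⟪w t, x⟫_ℝ ∂μx) ≤
        ‖w 0 - v‖ ^ 2 - ‖w T - v‖ ^ 2 := by
  have key := fun t => step_aux μx σ σ' L B η hσmeas hσ'meas hσmono hL hσlip hσ'nonneg hσ'le
    hmom hB v (w t) (w (t + 1)) (hupd t) hη hηle
  have hc : 0 < η * L⁻¹ := by positivity
  refine ⟨fun t _ => ?_, ?_⟩
  · have h := (key t).2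
    have h' := mul_nonneg hc.le (key t).1
    exact (sq_le_sq₀ (norm_nonneg _) (norm_nonneg _)).1 (by linarith)
  · induction T with
    | zero => simp
    | succ n ih =>
      rw [Finset.sum_range_succ, mul_add]
      have h := (key n).2
      have h' := mul_nonneg hc.le (key n).1
      linarith
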